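/- Let k ≥ 1 and let H be the finite simple graph on the vertex set {t, u_0, u_1, …, u_k} in which the vertices u_0, …, u_k are pairwise adjacent and each u_i is adjacent to t. Let ρ be the skipping forwarding pattern in which, at each u_i and for every in-port, the priority list is the sequence of edges to t, u_{i+1}, …, u_k, u_0, …, u_{i−1} in this order. Then for every failure scenario F with |F| ≤ k and every i ∈ {0, …, k}, the routing determined by ρ, u_i and F reaches t. -/

import Mathlib

open Classical

namespace FRR

variable {V : Type*}

/-- A forwarding function: given a failure scenario, the current vertex and an in-port,
return the link along which the packet is forwarded. -/
abbrev Fwd (V : Type*) := Set (Sym2 V) → V → Sym2 V → Sym2 V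

/-- `ρ` is a forwarding pattern for `G`: at each vertex it returns an incident link
(or the self-loop `s(v, v)`, which models staying at `v`), and whenever not all
incident links have failed, the returned link is active (not failed). -/
def IsFwdPattern (G : SimpleGraph V) (ρ : Fwd V) : Prop :=
  ∀ F ⊆ G.edgeSet, ∀ (v : V) (e : Sym2 V),
    ρ F v e ∈ G.incidenceSet v ∪ {s(v, v)} ∧
    (¬ G.incidenceSet v ⊆ F → ρ F v e ∉ F)

/-- `ρ` is local: its decisions only depend on the locally visible failed links. -/
def IsLocal (G : SimpleGraph V) (ρ : Fwd V) : Prop :=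
  ∀ F ⊆ G.edgeSet, ∀ F' ⊆ G.edgeSet, ∀ v : V,
    F ∩ G.incidenceSet v = F' ∩ G.incidenceSet v → ∀ e : Sym2 V, ρ F v e = ρ F' v e

/-- `ρ` is in-port oblivious: at every vertex and in every failure scenario its
decision does not depend on the in-port. -/
def InPortOblivious (G : SimpleGraph V) (ρ : Fwd V) : Prop :=
  ∀ F ⊆ G.edgeSet, ∀ (v : V) (e e' : Sym2 V), ρ F v e = ρ F v e'

/-- The endpoint of `e` other than `v` (or `v` itself if `v ∉ e`). -/
noncomputable def step (v : V) (e : Sym2 V) : V :=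
  if h : v ∈ e then Sym2.Mem.other h else v

/-- `route ρ F s₀ n = (π_n, π_{n+1})` where `π` is the routing determined by `ρ`,
the start vertex `s₀` and the failure scenario `F`; that is, `π_0 = π_1 = s₀`
(injection is modeled by the in-port `s(s₀, s₀)`) and
`ρ_{π_i}^F s(π_{i-1}, π_i) = s(π_i, π_{i+1})` for `i ≥ 1`. -/
noncomputable def route (ρ : Fwd V) (F : Set (Sym2 V)) (s₀ : V) : ℕ → V × V
  | 0 => (s₀, s₀)
  | n + 1 =>
    ((route ρ F s₀ n).2,
      step (route ρ F s₀ n).2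
        (ρ F (route ρ F s₀ n).2 s((route ρ F s₀ n).1, (route ρ F s₀ n).2)))

/-- The routing determined by `ρ`, `s₀` and `F` reaches `t`. -/
def Reaches (ρ : Fwd V) (F : Set (Sym2 V)) (s₀ t : V) : Prop :=
  ∃ n : ℕ, (route ρ F s₀ n).1 = t

/-- `ρ` is perfectly resilient for the target `t` in `G`: for every failure scenario
and every start vertex still connected to `t` after the failures, the routing
reaches `t`. -/
def PerfectlyResilient (G : SimpleGraph V) (ρ : Fwd V) (t : V) : Prop :=
  ∀ F ⊆ G.edgeSet, ∀ v : V, (G.deleteEdges F).Reachable v t → Reaches ρ F v t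

/-- `L` is a skipping priority list for `G`: for every vertex and every in-port it is
a duplicate-free enumeration of all links incident to the vertex. -/
def IsSkipList (G : SimpleGraph V) (L : V → Sym2 V → List (Sym2 V)) : Prop :=
  ∀ (v : V) (e : Sym2 V), (L v e).Nodup ∧ ∀ f : Sym2 V, f ∈ L v e ↔ f ∈ G.incidenceSet v

/-- The skipping forwarding pattern induced by a skipping priority list: forward
along the first link of the list that is not failed (staying at `v`, modeled by the
self-loop `s(v, v)`, if all incident links failed). -/
noncomputable def skipFwd (L : V → Sym2 V → List (Sym2 V)) : Fwd V :=
  fun F v e =>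
    match (L v e).find? (fun f => decide (f ∉ F)) with
    | some f => f
    | none => s(v, v)

end FRR

namespace FRR

/-- The priority list used at vertex `u_i` of the clique `{u_0, …, u_k} ∪ {t}`
(with `t = none` and `u_i = some i`): first the link to `t`, then the links to
`u_{i+1}, …, u_k, u_0, …, u_{i-1}` in this order. -/
def cliquePrio (k : ℕ) (i : Fin (k + 1)) : List (Sym2 (Option (Fin (k + 1)))) :=
  s(some i, (none : Option (Fin (k + 1)))) ::
    (List.range k).map fun j =>
      s((some i : Option (Fin (k + 1))),
        some (⟨(i.val + 1 + j) % (k + 1), Nat.mod_lt _ (Nat.succ_pos k)⟩ : Fin (k + 1)))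

end FRR

namespace FRR

/-- The clique vertex `q` places after `u_i` in the circular order. -/
def cliqueVertex (k : ℕ) (i : Fin (k + 1)) (q : ℕ) : Fin (k + 1) :=
  ⟨(i.val + q) % (k + 1), Nat.mod_lt _ (Nat.succ_pos k)⟩

theorem cliqueVertex_zero (k : ℕ) (i : Fin (k + 1)) : cliqueVertex k i 0 = i :=
  Fin.ext (Nat.mod_eq_of_lt i.isLt)

theorem cliqueVertex_cliqueVertex (k : ℕ) (i : Fin (k + 1)) (p q : ℕ) :
    cliqueVertex k (cliqueVertex k i p) q = cliqueVertex k i (p + q) := by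
  simp [cliqueVertex, Nat.add_assoc]

theorem cliqueVertex_inj {k : ℕ} {i : Fin (k + 1)} {p q : ℕ} (hp : p ≤ k) (hq : q ≤ k)
    (h : cliqueVertex k i p = cliqueVertex k i q) : p = q :=
  Nat.ModEq.eq_of_lt_of_lt (Nat.ModEq.add_left_cancel' i.val (congrArg Fin.val h))
    (Nat.lt_succ_of_le hp) (Nat.lt_succ_of_le hq)

theorem cliquePrio_eq (k : ℕ) (i : Fin (k + 1)) :
    cliquePrio k i = s(some i, none) ::
      (List.range k).map fun j => s(some i, some (cliqueVertex k i (j + 1))) := by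
  simp only [cliquePrio, cliqueVertex, Nat.add_assoc, Nat.add_comm 1]

theorem step_mk {V : Type*} (v w : V) : step v s(v, w) = w := by
  have h : v ∈ s(v, w) := Sym2.mem_mk_left v w
  rw [step, dif_pos h]
  exact Sym2.congr_right.1 (Sym2.other_spec h)

theorem route_succ_snd {V : Type*} {ρ : Fwd V} {F : Set (Sym2 V)} {s₀ v w : V} {n : ℕ}
    (hv : (route ρ F s₀ n).2 = v) (h : ∀ e, ρ F v e = s(v, w)) :
    (route ρ F s₀ (n + 1)).2 = w := by
  simp only [route, hv, h, step_mk]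

section Clique

variable {k : ℕ} {L : Option (Fin (k + 1)) → Sym2 (Option (Fin (k + 1))) →
    List (Sym2 (Option (Fin (k + 1))))} {F : Set (Sym2 (Option (Fin (k + 1))))}
  {i : Fin (k + 1)}

theorem skipFwd_target {e : Sym2 (Option (Fin (k + 1)))} (hL : L (some i) e = cliquePrio k i)
    (h : s(some i, none) ∉ F) : skipFwd L F (some i) e = s(some i, none) := by
  simp [skipFwd, hL, cliquePrio_eq, h]

theorem skipFwd_cliqueVertex {e : Sym2 (Option (Fin (k + 1)))}
    (hL : L (some i) e = cliquePrio k i) (ht : s(some i, none) ∈ F) {d : ℕ} (hd : d < k)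
    (hlt : ∀ j < d, s(some i, some (cliqueVertex k i (j + 1))) ∈ F)
    (h : s(some i, some (cliqueVertex k i (d + 1))) ∉ F) :
    skipFwd L F (some i) e = s(some i, some (cliqueVertex k i (d + 1))) := by
  have hfind : (List.range k).find?
      (fun j => decide (s(some i, some (cliqueVertex k i (j + 1))) ∉ F)) = some d := by
    rw [List.find?_range_eq_some]
    simpa [hd, h] using hlt
  simp only [skipFwd, hL, cliquePrio_eq]
  rw [List.find?_cons_of_neg (by simpa using ht), List.find?_map]
  simp only [Function.comp_def, hfind, Option.map_some]

theorem target_link_mem_of_not_reaches (hL : ∀ i e, L (some i) e = cliquePrio k i)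
    {s₀ : Option (Fin (k + 1))} (hr : ¬ Reaches (skipFwd L) F s₀ none) {n : ℕ}
    (hn : (route (skipFwd L) F s₀ n).2 = some i) : s(some i, none) ∈ F := by
  by_contra h
  exact hr ⟨n + 2, route_succ_snd hn fun e => skipFwd_target (hL i e) h⟩

/-- If the routing from `u_i` misses the target, every window position `q` lies behind a visited
position `p` whose links to the target and to all positions in `(p, q]` have failed. -/
theorem exists_failed_links_of_not_reaches (hL : ∀ i e, L (some i) e = cliquePrio k i)
    (hr : ¬ Reaches (skipFwd L) F (some i) none) (q : ℕ) (hq : q ≤ k) :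
    ∃ p ≤ q, (∃ n, (route (skipFwd L) F (some i) n).2 = some (cliqueVertex k i p)) ∧
      s(some (cliqueVertex k i p), none) ∈ F ∧
      ∀ r, p < r → r ≤ q → s(some (cliqueVertex k i p), some (cliqueVertex k i r)) ∈ F := by
  induction q with
  | zero =>
    have h0 : (route (skipFwd L) F (some i) 0).2 = some (cliqueVertex k i 0) := by
      rw [cliqueVertex_zero]; rfl
    exact ⟨0, le_rfl, ⟨0, h0⟩, target_link_mem_of_not_reaches hL hr h0, by omega⟩
  | succ q ih =>
    obtain ⟨p, hpq, ⟨n, hn⟩, ht, hp⟩ := ih (by omega)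
    by_cases h : s(some (cliqueVertex k i p), some (cliqueVertex k i (q + 1))) ∈ F
    · refine ⟨p, by omega, ⟨n, hn⟩, ht, fun r hpr hrq => ?_⟩
      rcases hrq.eq_or_lt with rfl | hlt
      · exact h
      · exact hp r hpr (by omega)
    · obtain ⟨d, rfl⟩ := Nat.exists_eq_add_of_le hpq
      have hn' : (route (skipFwd L) F (some i) (n + 1)).2 =
          some (cliqueVertex k i (p + d + 1)) := by
        refine route_succ_snd hn fun e => ?_
        have := skipFwd_cliqueVertex (d := d) (hL (cliqueVertex k i p) e) ht (by omega)
          (fun j hj => by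
            rw [cliqueVertex_cliqueVertex]
            exact hp _ (by omega) (by omega))
          (by rwa [cliqueVertex_cliqueVertex])
        rwa [cliqueVertex_cliqueVertex] at this
      exact ⟨p + d + 1, le_rfl, ⟨n + 1, hn'⟩, target_link_mem_of_not_reaches hL hr hn', by omega⟩

end Clique

/-- The link joining window position `q` to an earlier position `p`, or to the target if
`p = q`. -/
def windowLink (k : ℕ) (i : Fin (k + 1)) (p q : ℕ) : Sym2 (Option (Fin (k + 1))) :=
  s(some (cliqueVertex k i q), if p = q then none else some (cliqueVertex k i p))

theorem windowLink_inj {k : ℕ} {i : Fin (k + 1)} {p q p' q' : ℕ} (hp : p ≤ q) (hq : q ≤ k)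
    (hp' : p' ≤ q') (hq' : q' ≤ k) (h : windowLink k i p q = windowLink k i p' q') :
    q = q' := by
  rcases Sym2.eq_iff.1 h with ⟨h, -⟩ | ⟨h₁, h₂⟩
  · exact cliqueVertex_inj hq hq' (Option.some.inj h)
  · split_ifs at h₁ h₂
    have := cliqueVertex_inj hq (hp'.trans hq') (Option.some.inj h₁)
    have := cliqueVertex_inj (hp.trans hq) hq' (Option.some.inj h₂)
    omega

end FRR

open FRR in
/-- Let `k ≥ 1` and let `H` be the complete graph on the vertices
`t, u_0, …, u_k` (here `t = none` and `u_i = some i`).  With the skipping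
priority list that, at every `u_i` and for every in-port, is
`(t, u_{i+1}, …, u_k, u_0, …, u_{i-1})`, the routing started at any `u_i`
reaches `t` under every failure scenario with at most `k` failed links. -/
theorem clique_circular_skipping_reaches (k : ℕ) (hk : 1 ≤ k)
    (L : Option (Fin (k + 1)) → Sym2 (Option (Fin (k + 1))) →
      List (Sym2 (Option (Fin (k + 1)))))
    (hL : ∀ (i : Fin (k + 1)) (e : Sym2 (Option (Fin (k + 1)))),
      L (some i) e = cliquePrio k i)
    (F : Set (Sym2 (Option (Fin (k + 1)))))
    (hF : F ⊆ (⊤ : SimpleGraph (Option (Fin (k + 1)))).edgeSet)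
    (hFk : F.ncard ≤ k) (i : Fin (k + 1)) :
    Reaches (skipFwd L) F (some i) none := by
  by_contra hr
  choose! p hpq _ ht hp using exists_failed_links_of_not_reaches hL hr
  have hmem : ∀ q ∈ Set.Iic k, windowLink k i (p q) q ∈ F := by
    intro q hq
    rw [windowLink]
    split_ifs with h
    · simpa only [h] using ht q hq
    · rw [Sym2.eq_swap]
      exact hp q hq q (lt_of_le_of_ne (hpq q hq) h) le_rfl
  have hcard := Set.ncard_le_ncard_of_injOn _ hmem
    (fun q hq q' hq' h => windowLink_inj (hpq q hq) hq (hpq q' hq') hq' h) F.toFinite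
  rw [← Finset.coe_Iic, Set.ncard_coe_finset, Nat.card_Iic] at hcard
  omega
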